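/- arXiv:2009.09368 — 15 statements merged into one kernel-verified Lean document; each statement's English description precedes it below -/
import Mathlib

section
/- If T : M → 𝔤 is an H-twisted Rota-Baxter operator, then the bracket [u,v]_T := Tu•v − Tv•u + H(Tu,Tv) is a Lie bracket on M; in particular it is bilinear, skew-symmetric, and satisfies the Jacobi identity [u,[v,w]_T]_T + [v,[w,u]_T]_T + [w,[u,v]_T]_T = 0 for all u, v, w ∈ M. -/
/-- If `T` is an `H`-twisted Rota-Baxter operator, then
`[u,v]_T := Tu•v − Tv•u + H(Tu,Tv)` is a Lie bracket on `M`: bilinear, skew-symmetric and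
satisfying the Jacobi identity. -/
theorem stmt_1 {K : Type*} [Field K] [CharZero K]
    {g : Type*} [LieRing g] [LieAlgebra K g]
    {M : Type*} [AddCommGroup M] [Module K M]
    [LieRingModule g M] [LieModule K g M]
    (H : g →ₗ[K] g →ₗ[K] M)
    (Hskew : ∀ x y : g, H x y = - H y x)
    (Hcocycle : ∀ x y z : g,
      ⁅x, H y z⁆ + ⁅y, H z x⁆ + ⁅z, H x y⁆
        + H x ⁅y, z⁆ + H y ⁅z, x⁆ + H z ⁅x, y⁆ = 0)
    (T : M →ₗ[K] g)
    (hT : ∀ u v : M, ⁅T u, T v⁆ = T (⁅T u, v⁆ - ⁅T v, u⁆ + H (T u) (T v))) :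
    ∀ br : M → M → M,
      (∀ u v : M, br u v = ⁅T u, v⁆ - ⁅T v, u⁆ + H (T u) (T v)) →
      ((∀ (a : K) (u u' v : M), br (a • u + u') v = a • br u v + br u' v) ∧
       (∀ (a : K) (u v v' : M), br u (a • v + v') = a • br u v + br u v') ∧
       (∀ u v : M, br u v = - br v u) ∧
       (∀ u v w : M, br u (br v w) + br v (br w u) + br w (br u v) = 0)) := by
  intro br hbr
  have hTbr : ∀ u v : M, T (br u v) = ⁅T u, T v⁆ := fun u v => by rw [hbr, ← hT]
  refine ⟨?_, ?_, ?_, ?_⟩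
  · intro a u u' v
    simp only [hbr, map_add, map_smul, add_lie, lie_add, smul_lie, lie_smul,
      LinearMap.add_apply, LinearMap.smul_apply]
    module
  · intro a u v v'
    simp only [hbr, map_add, map_smul, add_lie, lie_add, smul_lie, lie_smul]
    module
  · intro u v
    rw [hbr, hbr, Hskew (T u) (T v)]
    abel
  · intro u v w
    have key : ∀ u v w : M, br u (br v w) =
        ⁅T u, ⁅T v, w⁆⁆ - ⁅T u, ⁅T w, v⁆⁆ + ⁅T u, H (T v) (T w)⁆
          - (⁅T v, ⁅T w, u⁆⁆ - ⁅T w, ⁅T v, u⁆⁆) + H (T u) ⁅T v, T w⁆ := by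
      intro u v w
      rw [hbr u (br v w), hTbr, hbr v w, lie_lie, lie_add, lie_sub]
    rw [key u v w, key v w u, key w u v, ← Hcocycle (T u) (T v) (T w)]
    abel
end

section
/- Let T : M → 𝔤 be an H-twisted Rota-Baxter operator and h : 𝔤 → M a linear map such that id_M − h∘T : M → M is bijective. Then T∘(id_M − h∘T)⁻¹ : M → 𝔤 is an (H + δh)-twisted Rota-Baxter operator. -/
/-- If `T` is an `H`-twisted Rota-Baxter operator and `h : 𝔤 → M` is linear with
`id_M − h∘T` bijective (witnessed by the linear equivalence `e`), then
`T∘(id_M − h∘T)⁻¹` is an `(H + δh)`-twisted Rota-Baxter operator. -/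
theorem stmt_4 {K : Type*} [Field K] [CharZero K]
    {g : Type*} [LieRing g] [LieAlgebra K g]
    {M : Type*} [AddCommGroup M] [Module K M]
    [LieRingModule g M] [LieModule K g M]
    (H : g →ₗ[K] g →ₗ[K] M)
    (Hskew : ∀ x y : g, H x y = - H y x)
    (Hcocycle : ∀ x y z : g,
      ⁅x, H y z⁆ + ⁅y, H z x⁆ + ⁅z, H x y⁆
        + H x ⁅y, z⁆ + H y ⁅z, x⁆ + H z ⁅x, y⁆ = 0)
    (T : M →ₗ[K] g)
    (hT : ∀ u v : M, ⁅T u, T v⁆ = T (⁅T u, v⁆ - ⁅T v, u⁆ + H (T u) (T v)))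
    (h : g →ₗ[K] M) (e : M ≃ₗ[K] M) (he : ∀ u : M, e u = u - h (T u)) :
    ∀ S : M → g, (∀ u : M, S u = T (e.symm u)) →
      ∀ u v : M, ⁅S u, S v⁆
        = S (⁅S u, v⁆ - ⁅S v, u⁆
            + (H (S u) (S v) + (⁅S u, h (S v)⁆ - ⁅S v, h (S u)⁆ - h ⁅S u, S v⁆))) := by
  intro S hS u v
  obtain ⟨a, rfl⟩ := e.surjective u
  obtain ⟨b, rfl⟩ := e.surjective v
  have ha : S (e a) = T a := by rw [hS, e.symm_apply_apply]
  have hb : S (e b) = T b := by rw [hS, e.symm_apply_apply]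
  rw [ha, hb]
  have key : ⁅T a, e b⁆ - ⁅T b, e a⁆
      + (H (T a) (T b) + (⁅T a, h (T b)⁆ - ⁅T b, h (T a)⁆ - h ⁅T a, T b⁆))
      = e (⁅T a, b⁆ - ⁅T b, a⁆ + H (T a) (T b)) := by
    rw [he (_ + _), ← hT a b, he a, he b, lie_sub, lie_sub]
    abel
  rw [key, hS, e.symm_apply_apply]
  exact hT a b
end

section
/- Let T : M → 𝔤 be an H-twisted Rota-Baxter operator and B : 𝔤 → M a 1-cocycle (i.e. B([x,y]) = x•B(y) − y•B(x) for all x,y ∈ 𝔤) such that id_M + B∘T : M → M is bijective. Then the gauge transformation T_B := T∘(id_M + B∘T)⁻¹ : M → 𝔤 is again an H-twisted Rota-Baxter operator. -/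
/-- If `T` is an `H`-twisted Rota-Baxter operator and `B : 𝔤 → M` is a 1-cocycle
with `id_M + B∘T` bijective (witnessed by the linear equivalence `e`), then the gauge
transformation `T_B = T∘(id_M + B∘T)⁻¹` is again an `H`-twisted Rota-Baxter operator. -/
theorem stmt_5 {K : Type*} [Field K] [CharZero K]
    {g : Type*} [LieRing g] [LieAlgebra K g]
    {M : Type*} [AddCommGroup M] [Module K M]
    [LieRingModule g M] [LieModule K g M]
    (H : g →ₗ[K] g →ₗ[K] M)
    (Hskew : ∀ x y : g, H x y = - H y x)
    (Hcocycle : ∀ x y z : g,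
      ⁅x, H y z⁆ + ⁅y, H z x⁆ + ⁅z, H x y⁆
        + H x ⁅y, z⁆ + H y ⁅z, x⁆ + H z ⁅x, y⁆ = 0)
    (T : M →ₗ[K] g)
    (hT : ∀ u v : M, ⁅T u, T v⁆ = T (⁅T u, v⁆ - ⁅T v, u⁆ + H (T u) (T v)))
    (B : g →ₗ[K] M) (hB : ∀ x y : g, B ⁅x, y⁆ = ⁅x, B y⁆ - ⁅y, B x⁆)
    (e : M ≃ₗ[K] M) (he : ∀ u : M, e u = u + B (T u)) :
    ∀ TB : M → g, (∀ u : M, TB u = T (e.symm u)) →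
      ∀ u v : M, ⁅TB u, TB v⁆
        = TB (⁅TB u, v⁆ - ⁅TB v, u⁆ + H (TB u) (TB v)) := by
  intro TB hTB u v
  obtain ⟨a, rfl⟩ := e.surjective u
  obtain ⟨b, rfl⟩ := e.surjective v
  have h1 : ∀ c, TB (e c) = T c := fun c => by rw [hTB, e.symm_apply_apply]
  have key : ⁅T a, e b⁆ - ⁅T b, e a⁆ + H (T a) (T b)
      = e (⁅T a, b⁆ - ⁅T b, a⁆ + H (T a) (T b)) := by
    rw [he (_ + _), ← hT, hB, he a, he b, lie_add, lie_add]
    abel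
  rw [h1, h1, key, h1, hT]
end

section
/- Let T : M → 𝔤 be an H-twisted Rota-Baxter operator and B : 𝔤 → M a 1-cocycle with id_M + B∘T bijective, and let T_B = T∘(id_M + B∘T)⁻¹. Then the bijective linear map id_M + B∘T : M → M is a Lie algebra isomorphism from (M, [·,·]_T) to (M, [·,·]_{T_B}), i.e. (id + B∘T)([u,v]_T) = [(id + B∘T)(u), (id + B∘T)(v)]_{T_B} for all u, v ∈ M. -/
/-- With `T`, `B`, `e = id_M + B∘T` as in the gauge transformation, the map
`id_M + B∘T` is a Lie algebra isomorphism from `(M, [·,·]_T)` to `(M, [·,·]_{T_B})`, where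
`T_B = T∘(id_M + B∘T)⁻¹`. -/
theorem stmt_6 {K : Type*} [Field K] [CharZero K]
    {g : Type*} [LieRing g] [LieAlgebra K g]
    {M : Type*} [AddCommGroup M] [Module K M]
    [LieRingModule g M] [LieModule K g M]
    (H : g →ₗ[K] g →ₗ[K] M)
    (Hskew : ∀ x y : g, H x y = - H y x)
    (Hcocycle : ∀ x y z : g,
      ⁅x, H y z⁆ + ⁅y, H z x⁆ + ⁅z, H x y⁆
        + H x ⁅y, z⁆ + H y ⁅z, x⁆ + H z ⁅x, y⁆ = 0)
    (T : M →ₗ[K] g)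
    (hT : ∀ u v : M, ⁅T u, T v⁆ = T (⁅T u, v⁆ - ⁅T v, u⁆ + H (T u) (T v)))
    (B : g →ₗ[K] M) (hB : ∀ x y : g, B ⁅x, y⁆ = ⁅x, B y⁆ - ⁅y, B x⁆)
    (e : M ≃ₗ[K] M) (he : ∀ u : M, e u = u + B (T u)) :
    ∀ TB : M → g, (∀ u : M, TB u = T (e.symm u)) →
      ∀ u v : M,
        e (⁅T u, v⁆ - ⁅T v, u⁆ + H (T u) (T v))
          = ⁅TB (e u), e v⁆ - ⁅TB (e v), e u⁆ + H (TB (e u)) (TB (e v)) := by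
  intro TB hTB u v
  have h1 : ∀ w : M, TB (e w) = T w := fun w => by rw [hTB, e.symm_apply_apply]
  rw [h1, h1, he (⁅T u, v⁆ - ⁅T v, u⁆ + H (T u) (T v)), ← hT, hB, he u, he v, lie_add, lie_add]
  abel
end

section
/- Let R : 𝔤 → 𝔤 be a bijective Reynolds operator on a Lie algebra 𝔤. Then R⁻¹ − id : 𝔤 → 𝔤 is a derivation of 𝔤, i.e. (R⁻¹ − id)([u,v]) = [(R⁻¹ − id)(u), v] + [u, (R⁻¹ − id)(v)] for all u, v ∈ 𝔤. -/
/-- If `R` is a bijective Reynolds operator on a Lie algebra `𝔤`, then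
`R⁻¹ − id` is a derivation of `𝔤`. -/
theorem stmt_7 {K : Type*} [Field K] [CharZero K]
    {g : Type*} [LieRing g] [LieAlgebra K g]
    (R : g ≃ₗ[K] g)
    (hR : ∀ x y : g, ⁅R x, R y⁆ = R (⁅R x, y⁆ + ⁅x, R y⁆ - ⁅R x, R y⁆)) :
    ∀ u v : g, R.symm ⁅u, v⁆ - ⁅u, v⁆
      = ⁅R.symm u - u, v⁆ + ⁅u, R.symm v - v⁆ := by
  intro u v
  have h := congrArg R.symm (hR (R.symm u) (R.symm v))
  simp only [LinearEquiv.apply_symm_apply, LinearEquiv.symm_apply_apply] at h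
  rw [h, sub_lie, lie_sub]
  abel
end

section
/- Let d : 𝔤 → 𝔤 be a derivation of a Lie algebra 𝔤 such that id + d : 𝔤 → 𝔤 is bijective. Then (id + d)⁻¹ is a Reynolds operator on 𝔤. -/
/-- If `d` is a derivation of a Lie algebra `𝔤` such that `id + d` is bijective
(witnessed by the linear equivalence `e`), then `(id + d)⁻¹` is a Reynolds operator on `𝔤`. -/
theorem stmt_8 {K : Type*} [Field K] [CharZero K]
    {g : Type*} [LieRing g] [LieAlgebra K g]
    (d : g →ₗ[K] g) (hd : ∀ x y : g, d ⁅x, y⁆ = ⁅d x, y⁆ + ⁅x, d y⁆)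
    (e : g ≃ₗ[K] g) (he : ∀ x : g, e x = x + d x) :
    ∀ x y : g, ⁅e.symm x, e.symm y⁆
      = e.symm (⁅e.symm x, y⁆ + ⁅x, e.symm y⁆ - ⁅e.symm x, e.symm y⁆) := by
  intro x y
  obtain ⟨u, rfl⟩ := e.surjective x
  obtain ⟨v, rfl⟩ := e.surjective y
  rw [LinearEquiv.eq_symm_apply]
  simp only [LinearEquiv.symm_apply_apply]
  rw [he, he, he, hd, lie_add, add_lie]
  abel
end

section
/- Let d : 𝔤 → 𝔤 be a nilpotent derivation of a Lie algebra 𝔤, say d^N = 0 for some N. Then R = Σ_{n=0}^{N−1} (−1)^n d^n (equivalently R = Σ_{n=0}^∞ (−1)^n d^n, which is a finite sum) is a Reynolds operator on 𝔤. -/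
/-- If `d` is a nilpotent derivation of a Lie algebra `𝔤` with `d^N = 0`, then
`R = Σ_{n=0}^{N−1} (−1)^n d^n` is a Reynolds operator on `𝔤`. -/
theorem stmt_9 {K : Type*} [Field K] [CharZero K]
    {g : Type*} [LieRing g] [LieAlgebra K g]
    (d : Module.End K g) (hd : ∀ x y : g, d ⁅x, y⁆ = ⁅d x, y⁆ + ⁅x, d y⁆)
    (N : ℕ) (hN : d ^ N = 0) :
    ∀ R : Module.End K g,
      R = ∑ n ∈ Finset.range N, ((-1 : K) ^ n) • d ^ n →
      ∀ x y : g, ⁅R x, R y⁆ = R (⁅R x, y⁆ + ⁅x, R y⁆ - ⁅R x, R y⁆) := by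
  intro R hR x y
  have hR' : R = ∑ n ∈ Finset.range N, (-d) ^ n := by
    rw [hR]
    refine Finset.sum_congr rfl fun n _ => ?_
    have h : -d = (-1 : K) • d := by simp
    rw [h, smul_pow]
  have hz : (-d) ^ N = 0 := by rw [neg_pow, hN, mul_zero]
  have h1 : (1 + d) * R = 1 := by
    have := mul_neg_geom_sum (-d) N
    rwa [hz, sub_neg_eq_add, sub_zero, ← hR'] at this
  have h2 : R * (1 + d) = 1 := by
    have := geom_sum_mul_neg (-d) N
    rwa [hz, sub_neg_eq_add, sub_zero, ← hR'] at this
  have e1 : ∀ z, R z + d (R z) = z := fun z => by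
    simpa using congrArg (fun f : Module.End K g => f z) h1
  have e2 : ∀ z, R (z + d z) = z := fun z => by
    simpa using congrArg (fun f : Module.End K g => f z) h2
  have key : ⁅R x, y⁆ + ⁅x, R y⁆ - ⁅R x, R y⁆ = ⁅R x, R y⁆ + d ⁅R x, R y⁆ := by
    have hx : ⁅x, R y⁆ = ⁅R x, R y⁆ + ⁅d (R x), R y⁆ := by rw [← add_lie, e1]
    have hy : ⁅R x, y⁆ = ⁅R x, R y⁆ + ⁅R x, d (R y)⁆ := by rw [← lie_add, e1]
    rw [hx, hy, hd]
    abel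
  rw [key, e2]
end

section
/- Let T : M → 𝔤 be an H-twisted Rota-Baxter operator. Define u •̄ x := [Tu, x] + T(x•u + H(x, Tu)) for u ∈ M, x ∈ 𝔤. Then •̄ is a representation of the Lie algebra (M, [·,·]_T) on the vector space 𝔤; that is, •̄ is bilinear and u •̄ (v •̄ x) − v •̄ (u •̄ x) = [u,v]_T •̄ x for all u, v ∈ M and x ∈ 𝔤. -/
/-- For an `H`-twisted Rota-Baxter operator `T`, the map
`u •̄ x := [Tu, x] + T(x•u + H(x, Tu))` is a representation of the Lie algebra `(M, [·,·]_T)`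
on `𝔤`: it is bilinear and satisfies `u •̄ (v •̄ x) − v •̄ (u •̄ x) = [u,v]_T •̄ x`. -/
theorem stmt_10 {K : Type*} [Field K] [CharZero K]
    {g : Type*} [LieRing g] [LieAlgebra K g]
    {M : Type*} [AddCommGroup M] [Module K M]
    [LieRingModule g M] [LieModule K g M]
    (H : g →ₗ[K] g →ₗ[K] M)
    (Hskew : ∀ x y : g, H x y = - H y x)
    (Hcocycle : ∀ x y z : g,
      ⁅x, H y z⁆ + ⁅y, H z x⁆ + ⁅z, H x y⁆
        + H x ⁅y, z⁆ + H y ⁅z, x⁆ + H z ⁅x, y⁆ = 0)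
    (T : M →ₗ[K] g)
    (hT : ∀ u v : M, ⁅T u, T v⁆ = T (⁅T u, v⁆ - ⁅T v, u⁆ + H (T u) (T v))) :
    ∀ act : M → g → g,
      (∀ (u : M) (x : g), act u x = ⁅T u, x⁆ + T (⁅x, u⁆ + H x (T u))) →
      ((∀ (a : K) (u u' : M) (x : g), act (a • u + u') x = a • act u x + act u' x) ∧
       (∀ (a : K) (u : M) (x x' : g), act u (a • x + x') = a • act u x + act u x') ∧
       (∀ (u v : M) (x : g),
          act u (act v x) - act v (act u x)
            = act (⁅T u, v⁆ - ⁅T v, u⁆ + H (T u) (T v)) x)) := by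
  intro act hact
  refine ⟨?_, ?_, ?_⟩
  · intro a u u' x
    simp only [hact, map_add, map_smul, add_lie, lie_add, smul_lie, lie_smul, smul_add]
    abel
  · intro a u x x'
    simp only [hact, map_add, map_smul, add_lie, lie_add, smul_lie, lie_smul, smul_add,
      LinearMap.add_apply, LinearMap.smul_apply]
    abel
  · intro u v x
    have key : ∀ (u v : M), act u (act v x) = ⁅T u, ⁅T v, x⁆⁆ +
        T (⁅T u, ⁅x, v⁆⁆ + ⁅T u, H x (T v)⁆ + ⁅⁅T v, x⁆, u⁆ + H ⁅T v, x⁆ (T u)) := by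
      intro u v
      rw [hact u, hact v, lie_add, hT u, Hskew (T u) (T _)]
      simp only [map_add, map_sub, map_neg, add_lie, lie_add, LinearMap.add_apply]
      abel
    have hc : ⁅T u, H x (T v)⁆ + H ⁅T v, x⁆ (T u) - ⁅T v, H x (T u)⁆ - H ⁅T u, x⁆ (T v)
        = ⁅x, H (T u) (T v)⁆ + H x ⁅T u, T v⁆ := by
      have h := Hcocycle x (T u) (T v)
      rw [Hskew (T v) x, lie_neg, ← lie_skew x (T u), map_neg, Hskew (T u) ⁅T v, x⁆,
        Hskew (T v) ⁅T u, x⁆] at h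
      simp only [lie_neg, map_neg, neg_neg] at h
      rw [Hskew x (T v), lie_neg]
      rw [Hskew x (T v), lie_neg] at h
      rw [← sub_eq_zero, ← neg_eq_zero, ← h]
      abel
    rw [key u v, key v u, hact, ← hT u v]
    have hm : ⁅T u, ⁅x, v⁆⁆ + ⁅T u, H x (T v)⁆ + ⁅⁅T v, x⁆, u⁆ + H ⁅T v, x⁆ (T u)
        - (⁅T v, ⁅x, u⁆⁆ + ⁅T v, H x (T u)⁆ + ⁅⁅T u, x⁆, v⁆ + H ⁅T u, x⁆ (T v))
        = ⁅x, ⁅T u, v⁆ - ⁅T v, u⁆ + H (T u) (T v)⁆ + H x ⁅T u, T v⁆ := by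
      rw [lie_add, lie_sub, add_assoc (⁅x, ⁅T u, v⁆⁆ - ⁅x, ⁅T v, u⁆⁆), ← hc, lie_lie (T v) x u, lie_lie (T u) x v]
      abel
    rw [← hm, lie_lie (T u) (T v) x, map_sub]
    abel
end

section
/- Let T : M → 𝔤 be an H-twisted Rota-Baxter operator and T₁ : M → 𝔤 a linear map such that T + tT₁ is an H-twisted Rota-Baxter operator for every scalar t ∈ 𝕂. Then T₁ is a 1-cocycle in the cohomology of T, i.e. for all u, v ∈ M: [Tu, T₁v] + [T₁u, Tv] = T₁(Tu•v − Tv•u + H(Tu,Tv)) + T(T₁u•v − T₁v•u + H(T₁u, Tv) + H(Tu, T₁v)). -/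
/-- If `T + tT₁` is an `H`-twisted Rota-Baxter operator for every scalar `t`,
then `T₁` is a 1-cocycle in the cohomology of `T`. -/
theorem stmt_11 {K : Type*} [Field K] [CharZero K]
    {g : Type*} [LieRing g] [LieAlgebra K g]
    {M : Type*} [AddCommGroup M] [Module K M]
    [LieRingModule g M] [LieModule K g M]
    (H : g →ₗ[K] g →ₗ[K] M)
    (Hskew : ∀ x y : g, H x y = - H y x)
    (Hcocycle : ∀ x y z : g,
      ⁅x, H y z⁆ + ⁅y, H z x⁆ + ⁅z, H x y⁆
        + H x ⁅y, z⁆ + H y ⁅z, x⁆ + H z ⁅x, y⁆ = 0)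
    (T T₁ : M →ₗ[K] g)
    (hdef : ∀ t : K, ∀ u v : M,
      ⁅(T + t • T₁) u, (T + t • T₁) v⁆
        = (T + t • T₁) (⁅(T + t • T₁) u, v⁆ - ⁅(T + t • T₁) v, u⁆
            + H ((T + t • T₁) u) ((T + t • T₁) v))) :
    ∀ u v : M,
      ⁅T u, T₁ v⁆ + ⁅T₁ u, T v⁆
        = T₁ (⁅T u, v⁆ - ⁅T v, u⁆ + H (T u) (T v))
          + T (⁅T₁ u, v⁆ - ⁅T₁ v, u⁆ + H (T₁ u) (T v) + H (T u) (T₁ v)) := by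
  intro u v
  have h := fun t : K => hdef t u v
  simp only [LinearMap.add_apply, LinearMap.smul_apply, map_add, map_sub, map_smul, add_lie,
    lie_add, smul_lie, lie_smul, smul_add, smul_sub] at h ⊢
  have h0 := h 0
  have h1 := h 1
  have h2 := h (-1)
  have h3 := h 2
  linear_combination (norm := module) (-(1/3) : K) • h2 - (1/2 : K) • h0 + h1 - (1/6 : K) • h3
end

section
/- Let T : M → 𝔤 be an H-twisted Rota-Baxter operator and let T₁, T₁' : M → 𝔤 be linear maps. Suppose there is an element x ∈ 𝔤 such that for all t ∈ 𝕂 and u ∈ M: (id_𝔤 + t[x,−])((T + tT₁)(u)) = (T + tT₁')(u + t(x•u + H(x, Tu))). Then T₁ − T₁' is the coboundary of x, i.e. T₁(u) − T₁'(u) = [Tu, x] + T(x•u + H(x, Tu)) for all u ∈ M. -/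
/-- If for some `x ∈ 𝔤` one has, for all `t` and `u`,
`(id_𝔤 + t[x,−])((T + tT₁)(u)) = (T + tT₁')(u + t(x•u + H(x,Tu)))`, then
`T₁ − T₁'` is the coboundary of `x`: `T₁(u) − T₁'(u) = [Tu, x] + T(x•u + H(x,Tu))`. -/
theorem stmt_12 {K : Type*} [Field K] [CharZero K]
    {g : Type*} [LieRing g] [LieAlgebra K g]
    {M : Type*} [AddCommGroup M] [Module K M]
    [LieRingModule g M] [LieModule K g M]
    (H : g →ₗ[K] g →ₗ[K] M)
    (Hskew : ∀ x y : g, H x y = - H y x)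
    (Hcocycle : ∀ x y z : g,
      ⁅x, H y z⁆ + ⁅y, H z x⁆ + ⁅z, H x y⁆
        + H x ⁅y, z⁆ + H y ⁅z, x⁆ + H z ⁅x, y⁆ = 0)
    (T T₁ T₁' : M →ₗ[K] g)
    (hT : ∀ u v : M, ⁅T u, T v⁆ = T (⁅T u, v⁆ - ⁅T v, u⁆ + H (T u) (T v)))
    (x : g)
    (hequiv : ∀ t : K, ∀ u : M,
      (T + t • T₁) u + t • ⁅x, (T + t • T₁) u⁆
        = (T + t • T₁') (u + t • (⁅x, u⁆ + H x (T u)))) :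
    ∀ u : M, T₁ u - T₁' u = ⁅T u, x⁆ + T (⁅x, u⁆ + H x (T u)) := by
  intro u
  have h1 := hequiv 1 u
  have h2 := hequiv (-1) u
  generalize ⁅x, u⁆ + H x (T u) = w at h1 h2 ⊢
  simp only [LinearMap.add_apply, LinearMap.neg_apply, LinearMap.smul_apply, map_add, map_smul, lie_add, lie_smul,
    one_smul, neg_smul, smul_add, neg_neg, lie_neg, map_neg] at h1 h2
  rw [← lie_skew (T u) x]
  have h3 : (2 : K) • (T₁ u - T₁' u - (-⁅x, T u⁆ + T w)) = 0 := by
    rw [two_smul]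
    have h4 := congrArg₂ (fun a b => a - b) h1 h2
    rw [← sub_eq_zero] at h4
    rw [← h4]
    abel
  exact sub_eq_zero.mp ((smul_eq_zero.mp h3).resolve_left two_ne_zero)
end

section
/- Let N : 𝔤 → 𝔤 be a Nijenhuis operator on a Lie algebra 𝔤. Then the bilinear operations x ∘ y := [Nx, y] and x ⋎ y := −N([x,y]) make 𝔤 an NS-Lie algebra: ⋎ is skew-symmetric and the identities (NS1) and (NS2) hold for all x, y, z ∈ 𝔤. -/
/-- If `N` is a Nijenhuis operator on a Lie algebra `𝔤`, then
`x ∘ y := [Nx, y]` and `x ⋎ y := −N([x,y])` make `𝔤` an NS-Lie algebra. -/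
theorem stmt_13 {K : Type*} [Field K] [CharZero K]
    {g : Type*} [LieRing g] [LieAlgebra K g]
    (Nop : g →ₗ[K] g)
    (hN : ∀ x y : g, ⁅Nop x, Nop y⁆ = Nop (⁅Nop x, y⁆ + ⁅x, Nop y⁆ - Nop ⁅x, y⁆)) :
    ∀ circ vee : g → g → g,
      (∀ x y : g, circ x y = ⁅Nop x, y⁆) →
      (∀ x y : g, vee x y = - Nop ⁅x, y⁆) →
      ((∀ x y : g, vee x y = - vee y x) ∧
       (∀ x y z : g,
          circ (circ x y) z - circ x (circ y z) - circ (circ y x) z + circ y (circ x z)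
            + circ (vee x y) z = 0) ∧
       (∀ x y z : g,
          vee x (circ y z - circ z y + vee y z)
            + vee y (circ z x - circ x z + vee z x)
            + vee z (circ x y - circ y x + vee x y)
            + circ x (vee y z) + circ y (vee z x) + circ z (vee x y) = 0)) := by
  intro circ vee hc hv
  simp only [hc, hv]
  refine ⟨?_, ?_, ?_⟩
  · intro x y
    rw [← lie_skew x y, map_neg]
  · intro x y z
    have h1 := congrArg (fun w => ⁅w, z⁆) (hN x y)
    have h2 := lie_lie (Nop x) (Nop y) z
    have h3 : ⁅x, Nop y⁆ = - ⁅Nop y, x⁆ := (lie_skew x (Nop y)).symm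
    simp only [h3, map_add, map_sub, map_neg, add_lie, sub_lie, neg_lie] at h1 ⊢
    rw [h2] at h1
    linear_combination (norm := module) -h1
  · intro x y z
    have e1 := hN x ⁅y, z⁆
    have e2 := hN y ⁅z, x⁆
    have e3 := hN z ⁅x, y⁆
    have j0 := congrArg (fun w => Nop (Nop w)) (lie_jacobi x y z)
    have j1 := congrArg Nop (lie_jacobi (Nop x) y z)
    have j2 := congrArg Nop (lie_jacobi x (Nop y) z)
    have j3 := congrArg Nop (lie_jacobi x y (Nop z))
    have s1 : ⁅x, Nop y⁆ = - ⁅Nop y, x⁆ := (lie_skew _ _).symm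
    have s2 : ⁅y, Nop z⁆ = - ⁅Nop z, y⁆ := (lie_skew _ _).symm
    have s3 : ⁅z, Nop x⁆ = - ⁅Nop x, z⁆ := (lie_skew _ _).symm
    simp only [s1, s2, s3, map_add, map_sub, map_neg, map_zero, lie_add, lie_sub, lie_neg]
      at e1 e2 e3 j0 j1 j2 j3 ⊢
    linear_combination (norm := module) -e1 - e2 - e3 + j0 - j1 - j2 - j3
end

section
/- Let (L, ∘, ⋎) be an NS-Lie algebra. Then the bracket [x, y] := x∘y − y∘x + x⋎y is a Lie bracket on L; in particular it is bilinear, skew-symmetric and satisfies the Jacobi identity [x,[y,z]] + [y,[z,x]] + [z,[x,y]] = 0 for all x, y, z ∈ L. -/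
/-- In an NS-Lie algebra `(L, ∘, ⋎)`, the bracket
`[x,y] := x∘y − y∘x + x⋎y` is a Lie bracket: bilinear, skew-symmetric and satisfying the
Jacobi identity. -/
theorem stmt_14 {K : Type*} [Field K] [CharZero K]
    {L : Type*} [AddCommGroup L] [Module K L]
    (circ vee : L →ₗ[K] L →ₗ[K] L)
    (hskew : ∀ x y : L, vee x y = - vee y x)
    (hNS1 : ∀ x y z : L,
      circ (circ x y) z - circ x (circ y z) - circ (circ y x) z + circ y (circ x z)
        + circ (vee x y) z = 0)
    (hNS2 : ∀ x y z : L,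
      vee x (circ y z - circ z y + vee y z)
        + vee y (circ z x - circ x z + vee z x)
        + vee z (circ x y - circ y x + vee x y)
        + circ x (vee y z) + circ y (vee z x) + circ z (vee x y) = 0) :
    ∀ br : L → L → L,
      (∀ x y : L, br x y = circ x y - circ y x + vee x y) →
      ((∀ (a : K) (x x' y : L), br (a • x + x') y = a • br x y + br x' y) ∧
       (∀ (a : K) (x y y' : L), br x (a • y + y') = a • br x y + br x y') ∧
       (∀ x y : L, br x y = - br y x) ∧
       (∀ x y z : L, br x (br y z) + br y (br z x) + br z (br x y) = 0)) := by
  intro br hbr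
  refine ⟨?_, ?_, ?_, ?_⟩
  · intro a x x' y
    simp only [hbr, map_add, map_smul, LinearMap.add_apply, LinearMap.smul_apply]
    module
  · intro a x y y'
    simp only [hbr, map_add, map_smul, LinearMap.add_apply, LinearMap.smul_apply]
    module
  · intro x y
    rw [hbr, hbr, hskew x y]
    abel
  · intro x y z
    have h1 := hNS1 x y z
    have h2 := hNS1 y z x
    have h3 := hNS1 z x y
    have h4 := hNS2 x y z
    simp only [hbr, map_add, map_sub, LinearMap.add_apply, LinearMap.sub_apply] at h4 ⊢
    linear_combination (norm := module) h4 - h1 - h2 - h3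
end

section
/- Let (A, ≺, ≻, □) be an associative NS-algebra. Then the operations x ∘ y := x ≻ y − y ≺ x and x ⋎ y := x □ y − y □ x make A an NS-Lie algebra: ⋎ is skew-symmetric and the identities (NS1) and (NS2) hold for all x, y, z ∈ A. -/
/-- If `(A, ≺, ≻, □)` is an associative NS-algebra, then
`x ∘ y := x ≻ y − y ≺ x` and `x ⋎ y := x □ y − y □ x` make `A` an NS-Lie algebra. -/
theorem stmt_15 {K : Type*} [Field K] [CharZero K]
    {A : Type*} [AddCommGroup A] [Module K A]
    (prec succ sq : A →ₗ[K] A →ₗ[K] A)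
    (hax1 : ∀ x y z : A,
      prec (prec x y) z = prec x (prec y z + succ y z + sq y z))
    (hax2 : ∀ x y z : A, prec (succ x y) z = succ x (prec y z))
    (hax3 : ∀ x y z : A,
      succ (prec x y + succ x y + sq x y) z = succ x (succ y z))
    (hax4 : ∀ x y z : A,
      prec (sq x y) z + sq (prec x y + succ x y + sq x y) z
        = succ x (sq y z) + sq x (prec y z + succ y z + sq y z)) :
    ∀ circ vee : A → A → A,
      (∀ x y : A, circ x y = succ x y - prec y x) →
      (∀ x y : A, vee x y = sq x y - sq y x) →
      ((∀ x y : A, vee x y = - vee y x) ∧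
       (∀ x y z : A,
          circ (circ x y) z - circ x (circ y z) - circ (circ y x) z + circ y (circ x z)
            + circ (vee x y) z = 0) ∧
       (∀ x y z : A,
          vee x (circ y z - circ z y + vee y z)
            + vee y (circ z x - circ x z + vee z x)
            + vee z (circ x y - circ y x + vee x y)
            + circ x (vee y z) + circ y (vee z x) + circ z (vee x y) = 0)) := by
  intro circ vee hc hv
  simp only [map_add, LinearMap.add_apply] at hax1 hax3 hax4
  refine ⟨fun x y => ?_, fun x y z => ?_, fun x y z => ?_⟩
  · rw [hv, hv, neg_sub]
  · simp only [hc, hv, map_sub, LinearMap.sub_apply]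
    linear_combination (norm := module) hax3 x y z - hax3 y x z
      + hax1 z x y - hax1 z y x - hax2 x z y + hax2 y z x
  · simp only [hc, hv, map_add, map_sub, LinearMap.sub_apply, LinearMap.add_apply]
    linear_combination (norm := module) hax4 y x z + hax4 x z y + hax4 z y x
      - hax4 x y z - hax4 y z x - hax4 z x y
end

section
/- Let T : M → 𝔤 be an H-twisted Rota-Baxter operator. Then the operations u ∘ v := Tu • v and u ⋎ v := H(Tu, Tv) make M an NS-Lie algebra: ⋎ is skew-symmetric and the identities (NS1) and (NS2) hold for all u, v, w ∈ M. -/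
/-- If `T : M → 𝔤` is an `H`-twisted Rota-Baxter operator, then
`u ∘ v := Tu • v` and `u ⋎ v := H(Tu, Tv)` make `M` an NS-Lie algebra. -/
theorem stmt_16 {K : Type*} [Field K] [CharZero K]
    {g : Type*} [LieRing g] [LieAlgebra K g]
    {M : Type*} [AddCommGroup M] [Module K M]
    [LieRingModule g M] [LieModule K g M]
    (H : g →ₗ[K] g →ₗ[K] M)
    (Hskew : ∀ x y : g, H x y = - H y x)
    (Hcocycle : ∀ x y z : g,
      ⁅x, H y z⁆ + ⁅y, H z x⁆ + ⁅z, H x y⁆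
        + H x ⁅y, z⁆ + H y ⁅z, x⁆ + H z ⁅x, y⁆ = 0)
    (T : M →ₗ[K] g)
    (hT : ∀ u v : M, ⁅T u, T v⁆ = T (⁅T u, v⁆ - ⁅T v, u⁆ + H (T u) (T v))) :
    ∀ circ vee : M → M → M,
      (∀ u v : M, circ u v = ⁅T u, v⁆) →
      (∀ u v : M, vee u v = H (T u) (T v)) →
      ((∀ u v : M, vee u v = - vee v u) ∧
       (∀ u v w : M,
          circ (circ u v) w - circ u (circ v w) - circ (circ v u) w + circ v (circ u w)
            + circ (vee u v) w = 0) ∧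
       (∀ u v w : M,
          vee u (circ v w - circ w v + vee v w)
            + vee v (circ w u - circ u w + vee w u)
            + vee w (circ u v - circ v u + vee u v)
            + circ u (vee v w) + circ v (vee w u) + circ w (vee u v) = 0)) := by
  intro circ vee hc hv
  refine ⟨fun u v => ?_, fun u v w => ?_, fun u v w => ?_⟩
  · rw [hv, hv]
    exact Hskew _ _
  · have h : ⁅⁅T u, T v⁆, w⁆ = ⁅T (⁅T u, v⁆ - ⁅T v, u⁆ + H (T u) (T v)), w⁆ := by
      rw [hT]
    rw [lie_lie, map_add, map_sub, add_lie, sub_lie] at h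
    simp only [hc, hv]
    rw [← sub_eq_zero] at h
    rw [← neg_eq_zero, ← h]
    abel
  · simp only [hc, hv, ← hT]
    rw [← Hcocycle (T u) (T v) (T w)]
    abel
end

section
/- Let J : 𝔤 ⊕ M → 𝔤 ⊕ M be the linear map given in block form by J(x, u) = (Nx + Tu, σx − Su) for linear maps N : 𝔤 → 𝔤, S : M → M, T : M → 𝔤, σ : 𝔤 → M. Then J is an H-twisted generalized complex structure on M over 𝔤 (i.e. J² = −id and [Jr, Js]^H − [r,s]^H − J([Jr, s]^H + [r, Js]^H) = 0 for all r, s ∈ 𝔤 ⊕ M) if and only if the following ten identities hold for all x, y ∈ 𝔤 and u, v ∈ M: (1) N∘T = T∘S; (2) N² + T∘σ = −id; (3) S∘σ = σ∘N; (4) S² + σ∘T = −id; (5) [Tu, Tv] = T(Tu•v − Tv•u); (6) Tu•Sv − Tv•Su − H(Tu, Tv) = S(Tu•v − Tv•u); (7) [Nx, Tu] − N([x, Tu]) = T(Nx•u − x•Su + H(x, Tu)); (8) σ([Tu, x]) − Tu•σx − H(Tu, Nx) = x•u + Nx•Su − S(Nx•u − x•Su + H(x, Tu)); (9) [Nx,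 Ny] − [x, y] − N([Nx, y] + [x, Ny]) = T(x•σy − y•σx + H(x, Ny) − H(y, Nx)); (10) Nx•σy − Ny•σx + H(Nx, Ny) − H(x, y) − σ([Nx, y] + [x, Ny]) = −S(x•σy − y•σx + H(x, Ny) − H(y, Nx)). -/
/-- A block-form linear map `J(x,u) = (Nx + Tu, σx − Su)` on `𝔤 ⊕ M` is an
`H`-twisted generalized complex structure on `M` over `𝔤` (i.e. `J² = −id` plus integrability
for the `H`-twisted semidirect product bracket) if and only if its structure components satisfy
the ten identities (1)–(10). -/
theorem stmt_18 {K : Type*} [Field K] [CharZero K]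
    {g : Type*} [LieRing g] [LieAlgebra K g]
    {M : Type*} [AddCommGroup M] [Module K M]
    [LieRingModule g M] [LieModule K g M]
    (H : g →ₗ[K] g →ₗ[K] M)
    (Hskew : ∀ x y : g, H x y = - H y x)
    (Hcocycle : ∀ x y z : g,
      ⁅x, H y z⁆ + ⁅y, H z x⁆ + ⁅z, H x y⁆
        + H x ⁅y, z⁆ + H y ⁅z, x⁆ + H z ⁅x, y⁆ = 0)
    (Nop : g →ₗ[K] g) (S : M →ₗ[K] M) (T : M →ₗ[K] g) (σ : g →ₗ[K] M) :
    ∀ (J : g × M → g × M) (br : g × M → g × M → g × M),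
      (∀ p : g × M, J p = (Nop p.1 + T p.2, σ p.1 - S p.2)) →
      (∀ p q : g × M, br p q = (⁅p.1, q.1⁆, ⁅p.1, q.2⁆ - ⁅q.1, p.2⁆ + H p.1 q.1)) →
      (((∀ p : g × M, J (J p) = -p) ∧
        (∀ p q : g × M, br (J p) (J q) - br p q - J (br (J p) q + br p (J q)) = 0))
       ↔
       ((∀ u : M, Nop (T u) = T (S u)) ∧
        (∀ x : g, Nop (Nop x) + T (σ x) = -x) ∧
        (∀ x : g, S (σ x) = σ (Nop x)) ∧
        (∀ u : M, S (S u) + σ (T u) = -u) ∧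
        (∀ u v : M, ⁅T u, T v⁆ = T (⁅T u, v⁆ - ⁅T v, u⁆)) ∧
        (∀ u v : M,
          ⁅T u, S v⁆ - ⁅T v, S u⁆ - H (T u) (T v) = S (⁅T u, v⁆ - ⁅T v, u⁆)) ∧
        (∀ (x : g) (u : M),
          ⁅Nop x, T u⁆ - Nop ⁅x, T u⁆
            = T (⁅Nop x, u⁆ - ⁅x, S u⁆ + H x (T u))) ∧
        (∀ (x : g) (u : M),
          σ ⁅T u, x⁆ - ⁅T u, σ x⁆ - H (T u) (Nop x)
            = ⁅x, u⁆ + ⁅Nop x, S u⁆ - S (⁅Nop x, u⁆ - ⁅x, S u⁆ + H x (T u))) ∧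
        (∀ x y : g,
          ⁅Nop x, Nop y⁆ - ⁅x, y⁆ - Nop (⁅Nop x, y⁆ + ⁅x, Nop y⁆)
            = T (⁅x, σ y⁆ - ⁅y, σ x⁆ + H x (Nop y) - H y (Nop x))) ∧
        (∀ x y : g,
          ⁅Nop x, σ y⁆ - ⁅Nop y, σ x⁆ + H (Nop x) (Nop y) - H x y
              - σ (⁅Nop x, y⁆ + ⁅x, Nop y⁆)
            = - S (⁅x, σ y⁆ - ⁅y, σ x⁆ + H x (Nop y) - H y (Nop x))))) := by
  intro J br hJ hbr
  have sk : ∀ x y : g, ⁅x, y⁆ = -⁅y, x⁆ := fun x y => (lie_skew x y).symm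
  constructor
  · rintro ⟨h1, h2⟩
    have a1 := fun x : g => h1 (x, 0)
    have a2 := fun u : M => h1 (0, u)
    have b1 := fun x y : g => h2 (x, 0) (y, 0)
    have b2 := fun (x : g) (u : M) => h2 (x, 0) (0, u)
    have b3 := fun u v : M => h2 (0, u) (0, v)
    simp only [hJ, hbr, Prod.ext_iff, Prod.fst_add, Prod.snd_add, Prod.fst_sub, Prod.snd_sub,
      Prod.fst_neg, Prod.snd_neg, Prod.fst_zero, Prod.snd_zero, map_zero, map_add, map_sub, map_neg,
      lie_add, add_lie, lie_sub, sub_lie, lie_zero, zero_lie, LinearMap.add_apply,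
      LinearMap.zero_apply, add_zero, zero_add, sub_zero, zero_sub, neg_zero, lie_neg] at a1 a2 b1 b2 b3
    simp only [map_add, map_sub]
    refine ⟨fun u => ?_, fun x => ?_, fun x => ?_, fun u => ?_, fun u v => ?_, fun u v => ?_,
      fun x u => ?_, fun x u => ?_, fun x y => ?_, fun x y => ?_⟩
    · linear_combination (norm := module) (a2 u).1
    · linear_combination (norm := module) (a1 x).1
    · linear_combination (norm := module) -(a1 x).2
    · linear_combination (norm := module) (a2 u).2
    · linear_combination (norm := module) (b3 u v).1
    · linear_combination (norm := module) -(b3 u v).2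
    · linear_combination (norm := module) (b2 x u).1
    · have e := congrArg σ (sk (T u) x)
      rw [map_neg] at e
      linear_combination (norm := module) (b2 x u).2 + e - Hskew (T u) (Nop x)
    · have e := congrArg T (Hskew y (Nop x))
      rw [map_neg] at e
      linear_combination (norm := module) (b1 x y).1 + e
    · have e := congrArg S (Hskew y (Nop x))
      rw [map_neg] at e
      linear_combination (norm := module) (b1 x y).2 - e
  · rintro ⟨c1, c2, c3, c4, c5, c6, c7, c8, c9, c10⟩
    simp only [map_add, map_sub] at c5 c6 c7 c8 c9 c10
    constructor
    · rintro ⟨x, u⟩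
      simp only [hJ, Prod.ext_iff, Prod.fst_neg, Prod.snd_neg, map_add, map_sub]
      constructor
      · linear_combination (norm := module) c1 u + c2 x
      · linear_combination (norm := module) c4 u - c3 x
    · rintro ⟨x, u⟩ ⟨y, v⟩
      simp only [hJ, hbr, Prod.ext_iff, Prod.fst_add, Prod.snd_add, Prod.fst_sub, Prod.snd_sub,
        Prod.fst_zero, Prod.snd_zero, map_add, map_sub,
        lie_add, add_lie, lie_sub, sub_lie, LinearMap.add_apply]
      have e1 := congrArg T (Hskew y (Nop x))
      have e2 := congrArg S (Hskew y (Nop x))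
      have e3 := congrArg T (Hskew y (T u))
      have e4 := congrArg S (Hskew y (T u))
      have e5 := congrArg σ (sk (T v) x)
      have e6 := congrArg Nop (sk y (T u))
      rw [map_neg] at e1 e2 e3 e4 e5 e6
      constructor
      · linear_combination (norm := module) c9 x y + c7 x v - c7 y u + c5 u v - e1 - e3 - e6
          + sk (Nop y) (T u)
      · linear_combination (norm := module) c10 x y + c8 x v - c8 y u - c6 u v + e2 + e4 - e5
          + Hskew (T v) (Nop x)
end
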